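/- arXiv:2508.12659 — 5 statements merged into one kernel-verified Lean document; each statement's English description precedes it below -/
import Mathlib

section
/- Fix real numbers q, t, a real λ > 0, and an integer n ≥ 1. Then, as the real parameter m tends to +∞ and with p = λ/m, the (q,t)-deformed Jacobi parameters of the binomial distribution converge to those of the (q,t)-Poisson distribution: m·p + (1 − 2p)·[n]_{q,t} → λ + [n]_{q,t}, and [n]_{q,t}·(m − [n−1]_{q,t})·p·(1 − p) → λ·[n]_{q,t}. -/
/-- The `(q,t)`-number (generalized Fibonacci number)
`[n]_{q,t} = ∑_{k=1}^{n} t^{n-k} q^{k-1}`, with `[0]_{q,t} = 0`. -/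
noncomputable def qtNum (q t : ℝ) (n : ℕ) : ℝ :=
  ∑ k ∈ Finset.Icc 1 n, t ^ (n - k) * q ^ (k - 1)

/-- The Poisson limit of the `(q,t)`-deformed Jacobi parameters of the binomial
distribution: as `m → +∞` with `p = λ/m`,
`m·p + (1 − 2p)·[n]_{q,t} → λ + [n]_{q,t}` and
`[n]_{q,t}·(m − [n−1]_{q,t})·p·(1 − p) → λ·[n]_{q,t}`. -/
theorem qt_poisson_limit (q t lam : ℝ) (hlam : 0 < lam) (n : ℕ) (hn : 1 ≤ n) :
    Filter.Tendsto (fun m : ℝ => m * (lam / m) + (1 - 2 * (lam / m)) * qtNum q t n)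
      Filter.atTop (nhds (lam + qtNum q t n)) ∧
    Filter.Tendsto
      (fun m : ℝ => qtNum q t n * (m - qtNum q t (n - 1)) * (lam / m) * (1 - lam / m))
      Filter.atTop (nhds (lam * qtNum q t n)) := by
  have hp : Filter.Tendsto (fun m : ℝ => lam / m) Filter.atTop (nhds 0) :=
    tendsto_const_nhds.div_atTop Filter.tendsto_id
  have hmp : Filter.Tendsto (fun m : ℝ => m * (lam / m)) Filter.atTop (nhds lam) :=
    tendsto_const_nhds.congr' <| by
      filter_upwards [Filter.eventually_ne_atTop 0] with m hm
      exact (mul_div_cancel₀ lam hm).symm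
  constructor
  · simpa using hmp.add (((hp.const_mul 2).const_sub 1).mul_const (qtNum q t n))
  · have h := ((hmp.sub (hp.const_mul (qtNum q t (n - 1)))).mul (hp.const_sub 1)).const_mul
      (qtNum q t n)
    convert h using 2 <;> ring
end

section
/- Let H be a real inner product space and let q, t be real numbers with t > 0. For all vectors ξ, ξ_1, …, ξ_n, η_1, …, η_{n+1} ∈ H, setting ζ_1 = ξ and ζ_{j+1} = ξ_j for 1 ≤ j ≤ n, one has t^{n(n+1)/2} · Σ_{σ ∈ Sym(Fin (n+1))} (q/t)^{inv(σ)} ∏_{j=1}^{n+1} ⟨ζ_j, η_{σ(j)}⟩ = Σ_{k=1}^{n+1} q^{k−1} t^{n+1−k} ⟨ξ, η_k⟩ · ( t^{n(n−1)/2} Σ_{τ ∈ Sym(Fin n)} (q/t)^{inv(τ)} ∏_{j=1}^{n} ⟨ξ_j, η^{(k)}_{τ(j)}⟩ ), where (η^{(k)}_1, …, η^{(k)}_n) is the list (η_1, …, η_{n+1}) with its k-th entry deleted, and inv(σ) = #{(i, j) : i < j, σ(i) > σ(j)}. (This expresses that the (q,t)-annihilation operator A_{q,t}(ξ), given by A_{q,t}(ξ)(η_1⊗⋯⊗η_{n+1})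 = Σ_{k=1}^{n+1} q^{k−1} t^{n+1−k} ⟨ξ, η_k⟩ η_1⊗⋯∨_k⋯⊗η_{n+1}, is the adjoint of the creation operator A†_{q,t}(ξ) with respect to the (q,t)-inner product.) -/
open scoped RealInnerProductSpace

/-- The number of inversions of a permutation `σ` of `{0,…,n−1}`:
`inv(σ) = #{(i,j) : i < j, σ(i) > σ(j)}`. -/
def inversions {n : ℕ} (σ : Equiv.Perm (Fin n)) : ℕ :=
  (Finset.univ.filter fun p : Fin n × Fin n => p.1 < p.2 ∧ σ p.2 < σ p.1).card

/-- The permutation of `Fin (n + 1)` sending `0` to `k` and `j.succ` to `k.succAbove (τ j)`. -/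
def permOfZeroImage {n : ℕ} (k : Fin (n + 1)) (τ : Equiv.Perm (Fin n)) :
    Equiv.Perm (Fin (n + 1)) :=
  (finSuccEquiv n).trans ((Equiv.optionCongr τ).trans (finSuccEquiv' k).symm)

@[simp]
theorem permOfZeroImage_zero {n : ℕ} (k : Fin (n + 1)) (τ : Equiv.Perm (Fin n)) :
    permOfZeroImage k τ 0 = k := by
  simp [permOfZeroImage]

@[simp]
theorem permOfZeroImage_succ {n : ℕ} (k : Fin (n + 1)) (τ : Equiv.Perm (Fin n)) (j : Fin n) :
    permOfZeroImage k τ j.succ = k.succAbove (τ j) := by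
  simp [permOfZeroImage]

theorem bijective_permOfZeroImage (n : ℕ) :
    Function.Bijective fun p : Fin (n + 1) × Equiv.Perm (Fin n) => permOfZeroImage p.1 p.2 := by
  refine (Fintype.bijective_iff_injective_and_card _).2 ⟨?_, ?_⟩
  · rintro ⟨k, τ⟩ ⟨l, ρ⟩ h
    have hkl : k = l := by simpa using DFunLike.congr_fun h 0
    subst hkl
    have hτρ : τ = ρ := Equiv.ext fun j => by simpa using DFunLike.congr_fun h j.succ
    rw [hτρ]
  · simp [Fintype.card_perm, Nat.factorial_succ]

theorem inversions_eq_sum {n : ℕ} (σ : Equiv.Perm (Fin n)) :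
    inversions σ = ∑ i, ∑ j, if i < j ∧ σ j < σ i then 1 else 0 := by
  rw [inversions, Finset.card_filter, Fintype.sum_prod_type]

theorem sum_ite_succAbove_lt {n : ℕ} (k : Fin (n + 1)) :
    ∑ j : Fin n, (if k.succAbove j < k then 1 else 0) = (k : ℕ) := by
  simp only [Fin.succAbove_lt_iff_castSucc_lt]
  simp only [Fin.lt_def, Fin.val_castSucc]
  rw [← Finset.card_filter, Fin.card_filter_val_lt]
  omega

theorem inversions_permOfZeroImage {n : ℕ} (k : Fin (n + 1)) (τ : Equiv.Perm (Fin n)) :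
    inversions (permOfZeroImage k τ) = k + inversions τ := by
  have h := Equiv.sum_comp τ fun j => if k.succAbove j < k then 1 else 0
  rw [sum_ite_succAbove_lt] at h
  simp [inversions_eq_sum, Fin.sum_univ_succ, h, -Finset.sum_boole]

theorem triangular_succ (n : ℕ) : n * (n + 1) / 2 = n * (n - 1) / 2 + n := by
  rw [← Nat.triangle_succ, Nat.add_sub_cancel, Nat.mul_comm]

theorem pow_mul_div_pow_add {q t : ℝ} (ht : t ≠ 0) {n k : ℕ} (hk : k ≤ n) (m : ℕ) :
    t ^ n * (q / t) ^ (k + m) = q ^ k * t ^ (n - k) * (q / t) ^ m := by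
  obtain ⟨d, rfl⟩ := Nat.exists_eq_add_of_le hk
  rw [Nat.add_sub_cancel_left, pow_add, pow_add, div_pow q t k]
  field_simp

/-- The `(q,t)`-annihilation operator is the adjoint of the `(q,t)`-creation operator
with respect to the `(q,t)`-inner product: for `ζ = (ξ, ξ_1, …, ξ_n)`,
`(ξ ⊗ ξ_1 ⊗ ⋯ ⊗ ξ_n | η_1 ⊗ ⋯ ⊗ η_{n+1})_{q,t}
  = ∑_{k=1}^{n+1} q^{k−1} t^{n+1−k} ⟨ξ, η_k⟩ · (ξ_1 ⊗ ⋯ ⊗ ξ_n | η_1 ⊗ ⋯ ∨_k ⋯ ⊗ η_{n+1})_{q,t}`. -/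
theorem qt_annihilation_adjoint (q t : ℝ) (ht : 0 < t)
    {H : Type*} [NormedAddCommGroup H] [InnerProductSpace ℝ H]
    (n : ℕ) (ξ : H) (ξs : Fin n → H) (η : Fin (n + 1) → H)
    (ζ : Fin (n + 1) → H) (hζ0 : ζ 0 = ξ) (hζ : ∀ j : Fin n, ζ j.succ = ξs j) :
    t ^ (n * (n + 1) / 2) *
        ∑ σ : Equiv.Perm (Fin (n + 1)), (q / t) ^ inversions σ * ∏ j, ⟪ζ j, η (σ j)⟫
      = ∑ k : Fin (n + 1), q ^ (k : ℕ) * t ^ (n - (k : ℕ)) * ⟪ξ, η k⟫ *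
          (t ^ (n * (n - 1) / 2) *
            ∑ τ : Equiv.Perm (Fin n),
              (q / t) ^ inversions τ * ∏ j, ⟪ξs j, η (k.succAbove (τ j))⟫) := by
  rw [← (bijective_permOfZeroImage n).sum_comp fun σ =>
    (q / t) ^ inversions σ * ∏ j, ⟪ζ j, η (σ j)⟫, Fintype.sum_prod_type, Finset.mul_sum]
  refine Finset.sum_congr rfl fun k _ => ?_
  simp only [Finset.mul_sum]
  refine Finset.sum_congr rfl fun τ _ => ?_
  rw [Fin.prod_univ_succ]
  simp only [permOfZeroImage_zero, permOfZeroImage_succ, hζ0, hζ, inversions_permOfZeroImage]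
  rw [triangular_succ, pow_add]
  linear_combination t ^ (n * (n - 1) / 2) * ⟪ξ, η k⟫ *
    (∏ j, ⟪ξs j, η (k.succAbove (τ j))⟫) *
      pow_mul_div_pow_add (q := q) ht.ne' (Nat.lt_succ_iff.1 k.isLt) (inversions τ)
end

section
/- In the one-mode (q,t)-Fock model with (q,t)-Poisson operator p = N + s·(a† + a) + λ·id (where s = √λ), the (q,t)-Charlier polynomials satisfy C_n(p) b_0 = s^n · b_n for every n ≥ 0, where C_n(p) denotes the evaluation of the polynomial C_n at the operator p. -/
open Polynomial

/-- In the one-mode `(q,t)`-Fock model with `(q,t)`-Poisson operator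
`p = N + s·(a† + a) + λ·id` (`s = √λ`), the `(q,t)`-Charlier polynomials satisfy
`C_n(p) b_0 = s^n · b_n` for every `n ≥ 0`. -/
theorem qt_charlier_poisson (q t lam : ℝ) (hq : q ∈ Set.Ioo (-1 : ℝ) 1)
    (hqt : |q| < t) (ht : t ≤ 1) (hlam : 0 < lam) (s : ℝ) (hs : s = Real.sqrt lam)
    (acr aan Nop : Module.End ℝ (ℕ →₀ ℝ))
    (hacr : ∀ n : ℕ, acr (Finsupp.single n 1) = Finsupp.single (n + 1) 1)
    (haan0 : aan (Finsupp.single 0 1) = 0)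
    (haan : ∀ n : ℕ, 1 ≤ n → aan (Finsupp.single n 1)
      = qtNum q t n • Finsupp.single (n - 1) 1)
    (hN : ∀ n : ℕ, Nop (Finsupp.single n 1) = qtNum q t n • Finsupp.single n 1)
    (p : Module.End ℝ (ℕ →₀ ℝ)) (hp : p = Nop + s • (acr + aan) + lam • 1)
    (C : ℕ → ℝ[X]) (hC0 : C 0 = 1) (hC1 : C 1 = X - Polynomial.C lam)
    (hCrec : ∀ n : ℕ, 1 ≤ n → C (n + 1)
      = (X - Polynomial.C (lam + qtNum q t n)) * C n
        - Polynomial.C (lam * qtNum q t n) * C (n - 1)) :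
    ∀ n : ℕ, (Polynomial.aeval p (C n)) (Finsupp.single 0 1)
      = s ^ n • Finsupp.single n 1 := by
  have hss : s * s = lam := hs ▸ Real.mul_self_sqrt hlam.le
  have hp0 : p (Finsupp.single 0 1) = s • Finsupp.single 1 1 + lam • Finsupp.single 0 1 := by
    simp only [hp, LinearMap.add_apply, LinearMap.smul_apply, Module.End.one_apply, hN, hacr,
      haan0]
    simp [qtNum]
  have hpsucc (n : ℕ) : p (Finsupp.single (n + 1) 1)
      = qtNum q t (n + 1) • Finsupp.single (n + 1) 1
        + s • (Finsupp.single (n + 2) 1 + qtNum q t (n + 1) • Finsupp.single n 1)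
        + lam • Finsupp.single (n + 1) 1 := by
    simp only [hp, LinearMap.add_apply, LinearMap.smul_apply, Module.End.one_apply, hN, hacr,
      haan (n + 1) n.succ_pos, Nat.add_sub_cancel]
  intro n
  induction n using Nat.twoStepInduction with
  | zero => simp [hC0]
  | one =>
    simp only [hC1, map_sub, aeval_X, aeval_C, LinearMap.sub_apply, Module.algebraMap_end_apply,
      hp0]
    module
  | more n ih₀ ih₁ =>
    rw [hCrec (n + 1) n.succ_pos, Nat.add_sub_cancel]
    simp only [map_sub, map_mul, aeval_X, aeval_C, LinearMap.sub_apply, Module.End.mul_apply,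
      Module.algebraMap_end_apply, ih₀, ih₁, map_smul, hpsucc, ← hss]
    module
end

section
/- In the one-mode (q,t)-Fock model with (q,t)-Poisson operator p = N + s·(a† + a) + λ·id (where s = √λ), the (q,t)-Charlier polynomials are orthogonal with respect to the vacuum form: for all m, n ≥ 0, B(C_n(p) b_0, C_m(p) b_0) = 0 if m ≠ n, and B(C_n(p) b_0, C_n(p) b_0) = λ^n · ∏_{k=1}^{n} [k]_{q,t}. -/
open Polynomial

/-- If `p` acts on the Fock basis by the three-term recurrence of the `(q,t)`-Poisson operator,
then the `n`-th `(q,t)`-Charlier polynomial in `p` sends the vacuum to `s ^ n • b_n`. -/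
theorem aeval_qtCharlier_vacuum {lam s : ℝ} (c : ℕ → ℝ) (hs : s ^ 2 = lam)
    {p : Module.End ℝ (ℕ →₀ ℝ)}
    (hp0 : p (Finsupp.single 0 1) = s • Finsupp.single 1 1 + lam • Finsupp.single 0 1)
    (hp : ∀ n : ℕ, p (Finsupp.single (n + 1) 1) = s • Finsupp.single (n + 2) 1
      + (lam + c (n + 1)) • Finsupp.single (n + 1) 1 + (s * c (n + 1)) • Finsupp.single n 1)
    {C : ℕ → ℝ[X]} (hC0 : C 0 = 1) (hC1 : C 1 = X - Polynomial.C lam)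
    (hCrec : ∀ n : ℕ, 1 ≤ n → C (n + 1)
      = (X - Polynomial.C (lam + c n)) * C n - Polynomial.C (lam * c n) * C (n - 1)) (n : ℕ) :
    aeval p (C n) (Finsupp.single 0 1) = s ^ n • Finsupp.single n 1 := by
  induction n using Nat.twoStepInduction with
  | zero => simp [hC0]
  | one => simp [hC1, hp0, Module.algebraMap_end_apply]
  | more n ih₀ ih₁ =>
    rw [hCrec (n + 1) (by simp), Nat.add_sub_cancel]
    simp only [map_sub, map_mul, aeval_X, aeval_C, LinearMap.sub_apply, Module.End.mul_apply,
      Module.algebraMap_end_apply, ih₀, ih₁, map_smul, hp, ← hs]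
    module

/-- In the one-mode `(q,t)`-Fock model with `(q,t)`-Poisson operator
`p = N + s·(a† + a) + λ·id` (`s = √λ`), the `(q,t)`-Charlier polynomials are orthogonal
with respect to the vacuum form: `B(C_n(p) b_0, C_m(p) b_0) = 0` for `m ≠ n`, and
`B(C_n(p) b_0, C_n(p) b_0) = λ^n · ∏_{k=1}^{n} [k]_{q,t}`. -/
theorem qt_charlier_orthogonality (q t lam : ℝ) (hq : q ∈ Set.Ioo (-1 : ℝ) 1)
    (hqt : |q| < t) (ht : t ≤ 1) (hlam : 0 < lam) (s : ℝ) (hs : s = Real.sqrt lam)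
    (acr aan Nop : Module.End ℝ (ℕ →₀ ℝ))
    (hacr : ∀ n : ℕ, acr (Finsupp.single n 1) = Finsupp.single (n + 1) 1)
    (haan0 : aan (Finsupp.single 0 1) = 0)
    (haan : ∀ n : ℕ, 1 ≤ n → aan (Finsupp.single n 1)
      = qtNum q t n • Finsupp.single (n - 1) 1)
    (hN : ∀ n : ℕ, Nop (Finsupp.single n 1) = qtNum q t n • Finsupp.single n 1)
    (p : Module.End ℝ (ℕ →₀ ℝ)) (hp : p = Nop + s • (acr + aan) + lam • 1)
    (C : ℕ → ℝ[X]) (hC0 : C 0 = 1) (hC1 : C 1 = X - Polynomial.C lam)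
    (hCrec : ∀ n : ℕ, 1 ≤ n → C (n + 1)
      = (X - Polynomial.C (lam + qtNum q t n)) * C n
        - Polynomial.C (lam * qtNum q t n) * C (n - 1))
    (B : (ℕ →₀ ℝ) →ₗ[ℝ] (ℕ →₀ ℝ) →ₗ[ℝ] ℝ)
    (hB : ∀ n m : ℕ, B (Finsupp.single n 1) (Finsupp.single m 1)
      = if n = m then ∏ k ∈ Finset.Icc 1 n, qtNum q t k else 0) :
    ∀ m n : ℕ,
      (m ≠ n → B (Polynomial.aeval p (C n) (Finsupp.single 0 1))
        (Polynomial.aeval p (C m) (Finsupp.single 0 1)) = 0) ∧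
      B (Polynomial.aeval p (C n) (Finsupp.single 0 1))
        (Polynomial.aeval p (C n) (Finsupp.single 0 1))
        = lam ^ n * ∏ k ∈ Finset.Icc 1 n, qtNum q t k := by
  have hs2 : s ^ 2 = lam := hs ▸ Real.sq_sqrt hlam.le
  have hp0 : p (Finsupp.single 0 1) = s • Finsupp.single 1 1 + lam • Finsupp.single 0 1 := by
    simp only [hp, LinearMap.add_apply, LinearMap.smul_apply, Module.End.one_apply, hN, hacr,
      haan0]
    simp [qtNum]
  have hpsucc : ∀ n : ℕ, p (Finsupp.single (n + 1) 1) = s • Finsupp.single (n + 2) 1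
      + (lam + qtNum q t (n + 1)) • Finsupp.single (n + 1) 1
      + (s * qtNum q t (n + 1)) • Finsupp.single n 1 := by
    intro n
    simp only [hp, LinearMap.add_apply, LinearMap.smul_apply, Module.End.one_apply, hN, hacr,
      haan (n + 1) (by simp), Nat.add_sub_cancel]
    module
  have hvac := aeval_qtCharlier_vacuum (qtNum q t) hs2 hp0 hpsucc hC0 hC1 hCrec
  intro m n
  simp only [hvac, map_smul, LinearMap.smul_apply, hB, smul_eq_mul]
  refine ⟨fun h => by simp [h.symm], ?_⟩
  rw [if_pos trivial, ← hs2]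
  ring
end

section
/- In the one-mode (q,t)-Fock model with (q,t)-Poisson operator p = N + s·(a† + a) + λ·id (where s = √λ), for every integer n ≥ 1 the n-th moment of the (q,t)-Poisson distribution, namely the vacuum expectation of p^n (the coefficient of b_0 in p^n b_0, i.e. the value of the finitely supported function p^n b_0 at 0), equals Σ_{π ∈ P(n)} λ^{|π|} · q^{rc(π)} · t^{rn(π)}, the sum ranging over all set partitions π of {1, …, n}. -/
open scoped Classical

/-- `f` follows `e` in the partition `P`: `e < f`, they lie in the same block of `P`,
and no element of that block lies strictly between `e` and `f`. -/
def Follows {n : ℕ} (P : Finset (Finset (Fin n))) (e f : Fin n) : Prop :=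
  e < f ∧ ∃ b ∈ P, e ∈ b ∧ f ∈ b ∧ ∀ g ∈ b, ¬(e < g ∧ g < f)

/-- `P` is a set partition of `{1,…,n}` (modeled as `Fin n`): its blocks are nonempty
and every element lies in exactly one block. -/
def IsSetPartition {n : ℕ} (P : Finset (Finset (Fin n))) : Prop :=
  (∀ b ∈ P, b.Nonempty) ∧ ∀ x : Fin n, ∃! b, b ∈ P ∧ x ∈ b

/-- The number of restricted crossings of `P`: quadruples `a < b < c < d` with
`c` following `a` and `d` following `b`. -/
noncomputable def rc {n : ℕ} (P : Finset (Finset (Fin n))) : ℕ :=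
  (Finset.univ.filter fun x : Fin n × Fin n × Fin n × Fin n =>
    x.1 < x.2.1 ∧ x.2.1 < x.2.2.1 ∧ x.2.2.1 < x.2.2.2 ∧
      Follows P x.1 x.2.2.1 ∧ Follows P x.2.1 x.2.2.2).card

/-- The number of restricted nestings of `P`: quadruples `a < b < c < d` with
`d` following `a` and `c` following `b`. -/
noncomputable def rn {n : ℕ} (P : Finset (Finset (Fin n))) : ℕ :=
  (Finset.univ.filter fun x : Fin n × Fin n × Fin n × Fin n =>
    x.1 < x.2.1 ∧ x.2.1 < x.2.2.1 ∧ x.2.2.1 < x.2.2.2 ∧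
      Follows P x.1 x.2.2.2 ∧ Follows P x.2.1 x.2.2.1).card

/-- `A` is a set of arcs `(i, j)`, `i < j < n`, in which every vertex is the left end of at most
one arc and the right end of at most one arc; `S` is a set of vertices that are not left ends,
thought of as the left ends of arcs still to be closed. -/
structure IsArcDiagram (n : ℕ) (A : Finset (ℕ × ℕ)) (S : Finset ℕ) : Prop where
  lt : ∀ ⦃i j⦄, (i, j) ∈ A → i < j
  bound : ∀ ⦃i j⦄, (i, j) ∈ A → j < n
  left : ∀ ⦃i j k⦄, (i, j) ∈ A → (i, k) ∈ A → j = k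
  right : ∀ ⦃i j k⦄, (i, k) ∈ A → (j, k) ∈ A → i = j
  open_lt : ∀ ⦃i⦄, i ∈ S → i < n
  open_free : ∀ ⦃i j⦄, i ∈ S → (i, j) ∉ A

/-- The finset of all arc diagrams on `{0, …, n - 1}`. -/
noncomputable def arcDiagrams (n : ℕ) : Finset (Finset (ℕ × ℕ) × Finset ℕ) :=
  ((Finset.range n ×ˢ Finset.range n).powerset ×ˢ (Finset.range n).powerset).filter
    fun x => IsArcDiagram n x.1 x.2

theorem mem_arcDiagrams {n : ℕ} {x : Finset (ℕ × ℕ) × Finset ℕ} :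
    x ∈ arcDiagrams n ↔ IsArcDiagram n x.1 x.2 := by
  simp only [arcDiagrams, Finset.mem_filter, Finset.mem_product, Finset.mem_powerset,
    and_iff_right_iff_imp]
  intro h
  refine ⟨?_, fun i hi => Finset.mem_range.2 (h.open_lt hi)⟩
  rintro ⟨i, j⟩ hij
  have h1 := h.lt hij
  have h2 := h.bound hij
  simp only [Finset.mem_product, Finset.mem_range]
  omega

/-- Crossings between two arcs, or between an arc and an open vertex. -/
def arcCrossings (A : Finset (ℕ × ℕ)) (S : Finset ℕ) : ℕ :=
  (∑ e ∈ A, ∑ f ∈ A, if e.1 < f.1 ∧ f.1 < e.2 ∧ e.2 < f.2 then 1 else 0) +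
    ∑ e ∈ A, ∑ b ∈ S, if e.1 < b ∧ b < e.2 then 1 else 0

/-- Nestings of two arcs, or of an arc under an open vertex. -/
def arcNestings (A : Finset (ℕ × ℕ)) (S : Finset ℕ) : ℕ :=
  (∑ e ∈ A, ∑ f ∈ A, if e.1 < f.1 ∧ f.2 < e.2 then 1 else 0) +
    ∑ e ∈ A, ∑ b ∈ S, if b < e.1 then 1 else 0

theorem sum_arcDiagrams_succ {M : Type*} [AddCommMonoid M] (n : ℕ)
    (f : Finset (ℕ × ℕ) → Finset ℕ → M) :
    ∑ x ∈ arcDiagrams (n + 1), f x.1 x.2 =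
      ∑ x ∈ arcDiagrams n, (f x.1 x.2 + f x.1 (insert n x.2) +
        ∑ i ∈ x.2, (f (insert (i, n) x.1) (x.2.erase i) +
          f (insert (i, n) x.1) (insert n (x.2.erase i)))) := by
  have open_last : ∑ x ∈ (arcDiagrams (n + 1)).filter (fun x => ¬ n ∉ x.2), f x.1 x.2 =
      ∑ x ∈ (arcDiagrams (n + 1)).filter (fun x => n ∉ x.2), f x.1 (insert n x.2) := by
    refine Finset.sum_bij' (fun x _ => (x.1, x.2.erase n)) (fun x _ => (x.1, insert n x.2))
      ?_ ?_ ?_ ?_ ?_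
    · rintro ⟨A, S⟩ h
      simp only [Finset.mem_filter, mem_arcDiagrams, not_not] at h ⊢
      refine ⟨⟨h.1.lt, h.1.bound, h.1.left, h.1.right, ?_, ?_⟩, by simp⟩
      · exact fun i hi => h.1.open_lt (Finset.mem_of_mem_erase hi)
      · exact fun i j hi => h.1.open_free (Finset.mem_of_mem_erase hi)
    · rintro ⟨A, S⟩ h
      simp only [Finset.mem_filter, mem_arcDiagrams, not_not] at h ⊢
      refine ⟨⟨h.1.lt, h.1.bound, h.1.left, h.1.right, ?_, ?_⟩, by simp⟩
      · intro i hi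
        rcases Finset.mem_insert.1 hi with rfl | hi
        · omega
        · exact h.1.open_lt hi
      · intro i j hi hij
        rcases Finset.mem_insert.1 hi with rfl | hi
        · have := h.1.lt hij
          have := h.1.bound hij
          omega
        · exact h.1.open_free hi hij
    · rintro ⟨A, S⟩ h
      simp only [Finset.mem_filter, not_not] at h
      simp [Finset.insert_erase h.2]
    · rintro ⟨A, S⟩ h
      simp only [Finset.mem_filter] at h
      simp [Finset.erase_insert h.2]
    · rintro ⟨A, S⟩ h
      simp only [Finset.mem_filter, not_not] at h
      simp [Finset.insert_erase h.2]
  have close_last (g : Finset (ℕ × ℕ) → Finset ℕ → M) :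
      ∑ x ∈ (arcDiagrams (n + 1)).filter (fun x => n ∉ x.2), g x.1 x.2 =
        ∑ x ∈ arcDiagrams n,
          (g x.1 x.2 + ∑ i ∈ x.2, g (insert (i, n) x.1) (x.2.erase i)) := by
    rw [Finset.sum_add_distrib,
      ← Finset.sum_filter_not_add_sum_filter _
        (fun x : Finset (ℕ × ℕ) × Finset ℕ => ∃ i, (i, n) ∈ x.1)]
    congr 1
    · refine Finset.sum_congr ?_ fun _ _ => rfl
      ext ⟨A, S⟩
      simp only [Finset.mem_filter, mem_arcDiagrams, not_exists]
      constructor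
      · rintro ⟨⟨h, hn⟩, hA⟩
        refine ⟨h.lt, ?_, h.left, h.right, ?_, h.open_free⟩
        · intro i j hij
          have := h.bound hij
          have : j ≠ n := by rintro rfl; exact hA _ hij
          omega
        · intro i hi
          have := h.open_lt hi
          have : i ≠ n := by rintro rfl; exact hn hi
          omega
      · intro h
        refine ⟨⟨⟨h.lt, fun i j hij => (h.bound hij).trans (Nat.lt_succ_self n), h.left, h.right,
          fun i hi => (h.open_lt hi).trans (Nat.lt_succ_self n), h.open_free⟩,
          fun hi => (h.open_lt hi).false⟩, fun i hi => (h.bound hi).false⟩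
    · rw [Finset.sum_sigma']
      symm
      refine Finset.sum_bij (fun x _ => (insert (x.2, n) x.1.1, x.1.2.erase x.2)) ?_ ?_ ?_ ?_
      · rintro ⟨⟨A, S⟩, i⟩ h
        simp only [Finset.mem_sigma, Finset.mem_filter, mem_arcDiagrams] at h ⊢
        obtain ⟨h, hi⟩ := h
        have hin := h.open_lt hi
        refine ⟨⟨⟨?_, ?_, ?_, ?_, ?_, ?_⟩, ?_⟩, i, by simp⟩
        · intro a b hab
          simp only [Finset.mem_insert, Prod.mk.injEq] at hab
          rcases hab with ⟨rfl, rfl⟩ | hab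
          · exact hin
          · exact h.lt hab
        · intro a b hab
          simp only [Finset.mem_insert, Prod.mk.injEq] at hab
          rcases hab with ⟨rfl, rfl⟩ | hab
          · omega
          · have := h.bound hab
            omega
        · intro a b c hab hac
          simp only [Finset.mem_insert, Prod.mk.injEq] at hab hac
          rcases hab with ⟨rfl, rfl⟩ | hab <;> rcases hac with ⟨h1, rfl⟩ | hac
          · rfl
          · exact (h.open_free hi hac).elim
          · exact (h.open_free hi (h1 ▸ hab)).elim
          · exact h.left hab hac
        · intro a b c hac hbc
          simp only [Finset.mem_insert, Prod.mk.injEq] at hac hbc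
          rcases hac with ⟨rfl, rfl⟩ | hac <;> rcases hbc with ⟨h1, h2⟩ | hbc
          · exact h1.symm
          · exact (h.bound hbc).false.elim
          · exact ((h.bound hac).ne h2).elim
          · exact h.right hac hbc
        · intro a ha
          have := h.open_lt (Finset.mem_of_mem_erase ha)
          omega
        · intro a b ha hab
          simp only [Finset.mem_erase, Finset.mem_insert, Prod.mk.injEq] at ha hab
          rcases hab with ⟨rfl, rfl⟩ | hab
          · exact ha.1 rfl
          · exact h.open_free ha.2 hab
        · exact fun hn => (h.open_lt (Finset.mem_of_mem_erase hn)).false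
      · rintro ⟨⟨A, S⟩, i⟩ h ⟨⟨B, T⟩, j⟩ h' heq
        simp only [Finset.mem_sigma, mem_arcDiagrams] at h h'
        simp only [Prod.mk.injEq] at heq
        obtain ⟨h, hi⟩ := h
        obtain ⟨h', hj⟩ := h'
        have hA : (i, n) ∉ A := fun hA => (h.bound hA).false
        have hB (k) : (k, n) ∉ B := fun hB => (h'.bound hB).false
        have hij : i = j := by
          have : (i, n) ∈ insert (j, n) B := heq.1 ▸ Finset.mem_insert_self _ _
          simp only [Finset.mem_insert, Prod.mk.injEq, and_true, hB, or_false] at this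
          exact this
        subst hij
        have h1 : A = B := by
          rw [← Finset.erase_insert hA, heq.1, Finset.erase_insert (hB i)]
        have h2 : S = T := by
          rw [← Finset.insert_erase hi, heq.2, Finset.insert_erase hj]
        subst h1 h2
        rfl
      · rintro ⟨A, S⟩ h
        simp only [Finset.mem_filter, mem_arcDiagrams] at h
        obtain ⟨⟨h, hn⟩, i, hi⟩ := h
        have hiS : i ∉ S := fun hS => h.open_free hS hi
        refine ⟨⟨(A.erase (i, n), insert i S), i⟩, ?_, ?_⟩
        · simp only [Finset.mem_sigma, mem_arcDiagrams, Finset.mem_insert_self, and_true]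
          refine ⟨fun a b hab => h.lt (Finset.mem_of_mem_erase hab), ?_,
            fun a b c hab hac =>
              h.left (Finset.mem_of_mem_erase hab) (Finset.mem_of_mem_erase hac),
            fun a b c hab hac =>
              h.right (Finset.mem_of_mem_erase hab) (Finset.mem_of_mem_erase hac), ?_, ?_⟩
          · intro a b hab
            simp only [Finset.mem_erase, ne_eq, Prod.mk.injEq, not_and] at hab
            have := h.bound hab.2
            have : b ≠ n := by
              rintro rfl
              exact hab.1 (h.right hab.2 hi) rfl
            omega
          · intro a ha
            rcases Finset.mem_insert.1 ha with rfl | ha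
            · exact h.lt hi
            · have := h.open_lt ha
              have : a ≠ n := by rintro rfl; exact hn ha
              omega
          · intro a b ha hab
            simp only [Finset.mem_erase, ne_eq, Prod.mk.injEq, not_and] at hab
            rcases Finset.mem_insert.1 ha with rfl | ha
            · exact hab.1 rfl (h.left hab.2 hi)
            · exact h.open_free ha hab.2
        · simp [Finset.insert_erase hi, Finset.erase_insert hiS]
      · intros
        rfl
  rw [← Finset.sum_filter_add_sum_filter_not _
    (fun x : Finset (ℕ × ℕ) × Finset ℕ => n ∉ x.2), open_last, ← Finset.sum_add_distrib,
    close_last fun A S => f A S + f A (insert n S)]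

theorem arcCrossings_insert_open {n : ℕ} {A : Finset (ℕ × ℕ)} {S : Finset ℕ}
    (hA : ∀ e ∈ A, e.1 < e.2 ∧ e.2 ≤ n) (hn : n ∉ S) :
    arcCrossings A (insert n S) = arcCrossings A S := by
  unfold arcCrossings
  congr 1
  refine Finset.sum_congr rfl fun e he => ?_
  have := hA e he
  rw [Finset.sum_insert hn, if_neg (by omega), zero_add]

theorem arcNestings_insert_open {n : ℕ} {A : Finset (ℕ × ℕ)} {S : Finset ℕ}
    (hA : ∀ e ∈ A, e.1 < e.2 ∧ e.2 ≤ n) (hn : n ∉ S) :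
    arcNestings A (insert n S) = arcNestings A S := by
  unfold arcNestings
  congr 1
  refine Finset.sum_congr rfl fun e he => ?_
  have := hA e he
  rw [Finset.sum_insert hn, if_neg (by omega), zero_add]

namespace IsArcDiagram

variable {n : ℕ} {A : Finset (ℕ × ℕ)} {S : Finset ℕ}

theorem lt_of_mem (h : IsArcDiagram n A S) {e : ℕ × ℕ} (he : e ∈ A) : e.1 < e.2 ∧ e.2 < n :=
  ⟨h.lt he, h.bound he⟩

theorem arcCrossings_close (h : IsArcDiagram n A S) {i : ℕ} (hi : i ∈ S) :
    arcCrossings (insert (i, n) A) (S.erase i) = arcCrossings A S + {b ∈ S | i < b}.card := by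
  have hA : (i, n) ∉ A := h.open_free hi
  have h1 : ∑ f ∈ A, (if i < f.1 ∧ f.1 < n ∧ n < f.2 then 1 else 0) = 0 :=
    Finset.sum_eq_zero fun f hf => by
      have := h.lt_of_mem hf
      rw [if_neg (by omega)]
  have h2 : ∑ e ∈ A, (if e.1 < i ∧ i < e.2 ∧ e.2 < n then 1 else 0) =
      ∑ e ∈ A, (if e.1 < i ∧ i < e.2 then 1 else 0) :=
    Finset.sum_congr rfl fun e he => by
      have := h.lt_of_mem he
      exact if_congr (by omega) rfl rfl
  have h3 : ∑ b ∈ S.erase i, (if i < b ∧ b < n then 1 else 0) = {b ∈ S | i < b}.card := by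
    rw [Finset.card_filter, ← Finset.add_sum_erase S _ hi, if_neg (lt_irrefl i), zero_add]
    refine Finset.sum_congr rfl fun b hb => ?_
    have := h.open_lt (Finset.mem_of_mem_erase hb)
    exact if_congr (by omega) rfl rfl
  have h4 : ∑ e ∈ A, ∑ b ∈ S, (if e.1 < b ∧ b < e.2 then 1 else 0) =
      ∑ e ∈ A, (if e.1 < i ∧ i < e.2 then 1 else 0) +
        ∑ e ∈ A, ∑ b ∈ S.erase i, (if e.1 < b ∧ b < e.2 then 1 else 0) := by
    rw [← Finset.sum_add_distrib]
    exact Finset.sum_congr rfl fun e _ => (Finset.add_sum_erase S _ hi).symm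
  unfold arcCrossings
  simp only [Finset.sum_insert hA, Finset.sum_add_distrib, lt_irrefl, false_and, if_false]
  rw [h1, h2, h3, h4]
  ring

theorem arcNestings_close (h : IsArcDiagram n A S) {i : ℕ} (hi : i ∈ S) :
    arcNestings (insert (i, n) A) (S.erase i) = arcNestings A S + {b ∈ S | b < i}.card := by
  have hA : (i, n) ∉ A := h.open_free hi
  have h1 : ∑ e ∈ A, (if e.1 < i ∧ n < e.2 then 1 else 0) = 0 :=
    Finset.sum_eq_zero fun f hf => by
      have := h.lt_of_mem hf
      rw [if_neg (by omega)]
  have h2 : ∑ f ∈ A, (if i < f.1 ∧ f.2 < n then 1 else 0) =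
      ∑ f ∈ A, (if i < f.1 then 1 else 0) :=
    Finset.sum_congr rfl fun e he => by
      have := h.lt_of_mem he
      exact if_congr (by omega) rfl rfl
  have h3 : ∑ b ∈ S.erase i, (if b < i then 1 else 0) = {b ∈ S | b < i}.card := by
    rw [Finset.card_filter, ← Finset.add_sum_erase S _ hi, if_neg (lt_irrefl i), zero_add]
  have h4 : ∑ e ∈ A, ∑ b ∈ S, (if b < e.1 then 1 else 0) =
      ∑ e ∈ A, (if i < e.1 then 1 else 0) +
        ∑ e ∈ A, ∑ b ∈ S.erase i, (if b < e.1 then 1 else 0) := by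
    rw [← Finset.sum_add_distrib]
    exact Finset.sum_congr rfl fun e _ => (Finset.add_sum_erase S _ hi).symm
  unfold arcNestings
  simp only [Finset.sum_insert hA, Finset.sum_add_distrib, lt_irrefl, false_and, if_false]
  rw [h1, h2, h3, h4]
  ring

theorem card_le (h : IsArcDiagram n A S) : A.card ≤ n := by
  rw [← Finset.card_range n]
  refine Finset.card_le_card_of_injOn Prod.snd (fun e he => ?_) ?_
  · simpa using (h.lt_of_mem he).2
  · rintro ⟨i, k⟩ hi ⟨j, l⟩ hj hkl
    obtain rfl : k = l := hkl
    rw [h.right hi hj]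

end IsArcDiagram

theorem qtNum_succ (q t : ℝ) (m : ℕ) : qtNum q t (m + 1) = q * qtNum q t m + t ^ m := by
  have key (k : ℕ) : qtNum q t k = ∑ j ∈ Finset.range k, t ^ (k - 1 - j) * q ^ j := by
    rw [qtNum, ← Finset.Ico_add_one_right_eq_Icc, Finset.sum_Ico_eq_sum_range,
      Nat.add_sub_cancel]
    refine Finset.sum_congr rfl fun j _ => ?_
    rw [Nat.add_sub_cancel_left, Nat.sub_sub]
  rw [key, key, Finset.sum_range_succ', Finset.mul_sum]
  congr 1
  · refine Finset.sum_congr rfl fun j _ => ?_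
    rw [show m + 1 - 1 - (j + 1) = m - 1 - j by omega]
    ring
  · simp

theorem sum_pow_card_eq_qtNum (q t : ℝ) (S : Finset ℕ) :
    ∑ i ∈ S, q ^ {b ∈ S | i < b}.card * t ^ {b ∈ S | b < i}.card = qtNum q t S.card := by
  induction S using Finset.induction_on_max with
  | empty => simp [qtNum]
  | insert a S ha ih =>
    have haS : a ∉ S := fun h => (ha a h).false
    rw [Finset.sum_insert haS, Finset.card_insert_of_notMem haS, qtNum_succ, ← ih,
      Finset.mul_sum, add_comm]
    congr 1
    · refine Finset.sum_congr rfl fun i hi => ?_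
      have := ha i hi
      rw [Finset.filter_insert, if_pos this, Finset.filter_insert, if_neg (by omega),
        Finset.card_insert_of_notMem (by simp [haS]), pow_succ]
      ring
    · rw [Finset.filter_insert, if_neg (lt_irrefl a), Finset.filter_insert,
        if_neg (lt_irrefl a), Finset.filter_true_of_mem ha, Finset.filter_false_of_mem]
      · simp
      · exact fun x hx => (ha x hx).le.not_gt

/-- The weight of an arc diagram. -/
noncomputable def arcWeight (q t lam : ℝ) (n : ℕ) (A : Finset (ℕ × ℕ)) (S : Finset ℕ) : ℝ :=
  lam ^ (n - A.card) * q ^ arcCrossings A S * t ^ arcNestings A S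

theorem pow_apply_vacuum (q t s : ℝ) (hs : s ≠ 0) (p : Module.End ℝ (ℕ →₀ ℝ))
    (hp : ∀ m, p (Finsupp.single m 1) = qtNum q t m • Finsupp.single m 1 +
      s • (Finsupp.single (m + 1) 1 + qtNum q t m • Finsupp.single (m - 1) 1) +
      s ^ 2 • Finsupp.single m 1) (n : ℕ) :
    (p ^ n) (Finsupp.single 0 1) = ∑ x ∈ arcDiagrams n,
      (arcWeight q t (s ^ 2) n x.1 x.2 * s⁻¹ ^ x.2.card) • Finsupp.single x.2.card 1 := by
  have hpow (k : ℕ) : s * s⁻¹ ^ (k + 1) = s⁻¹ ^ k := by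
    rw [pow_succ', mul_inv_cancel_left₀ hs]
  induction n with
  | zero =>
    have : arcDiagrams 0 = {(∅, ∅)} := by
      ext ⟨A, S⟩
      rw [mem_arcDiagrams, Finset.mem_singleton, Prod.mk.injEq]
      constructor
      · intro h
        refine ⟨Finset.eq_empty_of_forall_notMem fun e he => ?_,
          Finset.eq_empty_of_forall_notMem fun e he => ?_⟩
        · exact Nat.not_lt_zero _ (h.lt_of_mem he).2
        · exact Nat.not_lt_zero _ (h.open_lt he)
      · rintro ⟨rfl, rfl⟩
        constructor <;> simp
    have hw : arcWeight q t (s ^ 2) 0 ∅ ∅ = 1 := by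
      simp [arcWeight, arcCrossings, arcNestings]
    rw [this, Finset.sum_singleton, hw, Finset.card_empty, pow_zero, pow_zero, one_mul, one_smul,
      Module.End.one_apply]
  | succ n ih =>
    rw [pow_succ', Module.End.mul_apply, ih, map_sum, sum_arcDiagrams_succ n fun A S =>
      (arcWeight q t (s ^ 2) (n + 1) A S * s⁻¹ ^ S.card) • Finsupp.single S.card (1 : ℝ)]
    refine Finset.sum_congr rfl ?_
    rintro ⟨A, S⟩ hx
    have h : IsArcDiagram n A S := mem_arcDiagrams.1 hx
    have hnS : n ∉ S := fun hn => (h.open_lt hn).false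
    have hcard : n + 1 - A.card = n - A.card + 1 := by
      have := h.card_le
      omega
    have hclose : ∀ i ∈ S, arcWeight q t (s ^ 2) (n + 1) (insert (i, n) A) (S.erase i) =
        arcWeight q t (s ^ 2) n A S *
          (q ^ {b ∈ S | i < b}.card * t ^ {b ∈ S | b < i}.card) := by
      intro i hi
      rw [arcWeight, arcWeight, h.arcCrossings_close hi, h.arcNestings_close hi,
        Finset.card_insert_of_notMem (h.open_free hi), Nat.add_sub_add_right]
      ring
    have hclose' : ∀ i ∈ S,
        arcWeight q t (s ^ 2) (n + 1) (insert (i, n) A) (insert n (S.erase i)) =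
          arcWeight q t (s ^ 2) (n + 1) (insert (i, n) A) (S.erase i) := by
      intro i hi
      have hA : ∀ e ∈ insert (i, n) A, e.1 < e.2 ∧ e.2 ≤ n := by
        intro e he
        rcases Finset.mem_insert.1 he with rfl | he
        · exact ⟨h.open_lt hi, le_rfl⟩
        · exact ⟨(h.lt_of_mem he).1, (h.lt_of_mem he).2.le⟩
      have hn : n ∉ S.erase i := fun hn => hnS (Finset.mem_of_mem_erase hn)
      rw [arcWeight, arcWeight, arcCrossings_insert_open hA hn, arcNestings_insert_open hA hn]
    have hopen : arcWeight q t (s ^ 2) (n + 1) A (insert n S) =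
        s ^ 2 * arcWeight q t (s ^ 2) n A S := by
      have hA : ∀ e ∈ A, e.1 < e.2 ∧ e.2 ≤ n :=
        fun e he => ⟨(h.lt_of_mem he).1, (h.lt_of_mem he).2.le⟩
      rw [arcWeight, arcWeight, arcCrossings_insert_open hA hnS, arcNestings_insert_open hA hnS,
        hcard]
      ring
    have hsingle : arcWeight q t (s ^ 2) (n + 1) A S = s ^ 2 * arcWeight q t (s ^ 2) n A S := by
      rw [arcWeight, arcWeight, hcard]
      ring
    have hsum : ∑ i ∈ S,
        ((arcWeight q t (s ^ 2) (n + 1) (insert (i, n) A) (S.erase i) *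
            s⁻¹ ^ (S.erase i).card) • Finsupp.single (S.erase i).card (1 : ℝ) +
          (arcWeight q t (s ^ 2) (n + 1) (insert (i, n) A) (insert n (S.erase i)) *
            s⁻¹ ^ (insert n (S.erase i)).card) •
              Finsupp.single (insert n (S.erase i)).card (1 : ℝ)) =
        (arcWeight q t (s ^ 2) n A S * qtNum q t S.card * s⁻¹ ^ S.card) •
          (s • Finsupp.single (S.card - 1) (1 : ℝ) + Finsupp.single S.card (1 : ℝ)) := by
      rw [← sum_pow_card_eq_qtNum, Finset.mul_sum, Finset.sum_mul, Finset.sum_smul]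
      refine Finset.sum_congr rfl fun i hi => ?_
      have hpos : S.card - 1 + 1 = S.card := Nat.sub_add_cancel (Finset.card_pos.2 ⟨i, hi⟩)
      rw [hclose' i hi, hclose i hi, Finset.card_insert_of_notMem
        (fun hn => hnS (Finset.mem_of_mem_erase hn)), Finset.card_erase_of_mem hi, hpos,
        smul_add, smul_smul]
      congr 2
      rw [← hpos, Nat.add_sub_cancel, ← hpow (S.card - 1)]
      ring
    simp only [map_smul]
    rw [hsum, hopen, hsingle, hp, Finset.card_insert_of_notMem hnS]
    have : s ^ 2 * arcWeight q t (s ^ 2) n A S * s⁻¹ ^ (S.card + 1) =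
        s * arcWeight q t (s ^ 2) n A S * s⁻¹ ^ S.card := by
      rw [← hpow S.card]
      ring
    rw [this]
    module

/-- The first element of the chain of arcs of `A` ending at a given vertex. -/
noncomputable def arcRoot (A : Finset (ℕ × ℕ)) (j : ℕ) : ℕ :=
  if h : ∃ i, i < j ∧ (i, j) ∈ A then arcRoot A h.choose else j
termination_by j
decreasing_by exact h.choose_spec.1

namespace IsArcDiagram

variable {n : ℕ} {A : Finset (ℕ × ℕ)} {S : Finset ℕ}

theorem arcRoot_of_mem (h : IsArcDiagram n A S) {i j : ℕ} (hij : (i, j) ∈ A) :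
    arcRoot A j = arcRoot A i := by
  have hex : ∃ i, i < j ∧ (i, j) ∈ A := ⟨i, h.lt hij, hij⟩
  rw [arcRoot, dif_pos hex, h.right hex.choose_spec.2 hij]

theorem arcRoot_of_forall_notMem {j : ℕ} (hj : ∀ i, (i, j) ∉ A) : arcRoot A j = j := by
  rw [arcRoot, dif_neg fun ⟨i, hi⟩ => hj i hi.2]

theorem arcRoot_le (h : IsArcDiagram n A S) (j : ℕ) : arcRoot A j ≤ j := by
  induction j using Nat.strong_induction_on with
  | _ j ih =>
    by_cases hj : ∃ i, (i, j) ∈ A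
    · obtain ⟨i, hi⟩ := hj
      rw [h.arcRoot_of_mem hi]
      exact (ih i (h.lt hi)).trans (h.lt hi).le
    · rw [arcRoot_of_forall_notMem (not_exists.1 hj)]

theorem exists_mem_of_arcRoot_lt {j : ℕ} (hj : arcRoot A j < j) : ∃ i, (i, j) ∈ A := by
  by_contra hne
  exact hj.ne (arcRoot_of_forall_notMem (not_exists.1 hne))

theorem arcRoot_eq_self_iff (h : IsArcDiagram n A S) {j : ℕ} :
    arcRoot A j = j ↔ ∀ i, (i, j) ∉ A := by
  refine ⟨fun hj i hi => ?_, arcRoot_of_forall_notMem⟩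
  have h1 := h.arcRoot_of_mem hi
  have h2 := h.arcRoot_le i
  have h3 := h.lt hi
  omega

theorem arcRoot_arcRoot (h : IsArcDiagram n A S) (j : ℕ) :
    arcRoot A (arcRoot A j) = arcRoot A j := by
  induction j using Nat.strong_induction_on with
  | _ j ih =>
    by_cases hj : ∃ i, (i, j) ∈ A
    · obtain ⟨i, hi⟩ := hj
      rw [h.arcRoot_of_mem hi]
      exact ih i (h.lt hi)
    · rw [arcRoot_of_forall_notMem (not_exists.1 hj),
        arcRoot_of_forall_notMem (not_exists.1 hj)]

theorem arcRoot_ne_of_between (h : IsArcDiagram n A S) {i g j : ℕ} (hij : (i, j) ∈ A)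
    (hig : i < g) (hgj : g < j) : arcRoot A g ≠ arcRoot A i := by
  induction g using Nat.strong_induction_on generalizing i j with
  | _ g ih =>
    intro hroot
    obtain ⟨k, hk⟩ := exists_mem_of_arcRoot_lt (A := A) (j := g)
      (hroot ▸ (h.arcRoot_le i).trans_lt hig)
    have hkroot : arcRoot A k = arcRoot A i := (h.arcRoot_of_mem hk).symm.trans hroot
    rcases lt_trichotomy k i with hki | rfl | hki
    · exact ih i hig hk hki hig hkroot.symm
    · exact hgj.ne (h.left hk hij)
    · exact ih k (h.lt hk) hij hki ((h.lt hk).trans hgj) hkroot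

end IsArcDiagram

/-- The partition of `Fin n` whose blocks are the chains of arcs of `A`. -/
noncomputable def blocksOf (n : ℕ) (A : Finset (ℕ × ℕ)) : Finset (Finset (Fin n)) :=
  Finset.univ.image fun x : Fin n => Finset.univ.filter fun y : Fin n => arcRoot A y = arcRoot A x

/-- The arcs joining consecutive elements of the blocks of `P`. -/
noncomputable def arcsOf {n : ℕ} (P : Finset (Finset (Fin n))) : Finset (ℕ × ℕ) :=
  (Finset.univ.filter fun e : Fin n × Fin n => Follows P e.1 e.2).image
    fun e => ((e.1 : ℕ), (e.2 : ℕ))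

section Partition

variable {n : ℕ} {P : Finset (Finset (Fin n))} {A : Finset (ℕ × ℕ)} {S : Finset ℕ}

theorem mem_arcsOf {i j : ℕ} :
    (i, j) ∈ arcsOf P ↔ ∃ e f : Fin n, Follows P e f ∧ (e : ℕ) = i ∧ (f : ℕ) = j := by
  simp [arcsOf]

theorem val_mem_arcsOf {e f : Fin n} : ((e : ℕ), (f : ℕ)) ∈ arcsOf P ↔ Follows P e f := by
  rw [mem_arcsOf]
  constructor
  · rintro ⟨e', f', h, he, hf⟩
    rwa [← Fin.ext he, ← Fin.ext hf]
  · exact fun h => ⟨e, f, h, rfl, rfl⟩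

theorem IsSetPartition.eq_of_mem (hP : IsSetPartition P) {b c : Finset (Fin n)} {x : Fin n}
    (hb : b ∈ P) (hc : c ∈ P) (hxb : x ∈ b) (hxc : x ∈ c) : b = c :=
  (hP.2 x).unique ⟨hb, hxb⟩ ⟨hc, hxc⟩

theorem IsSetPartition.isArcDiagram_arcsOf (hP : IsSetPartition P) :
    IsArcDiagram n (arcsOf P) ∅ := by
  refine ⟨?_, ?_, ?_, ?_, by simp, by simp⟩
  · intro i j hij
    obtain ⟨e, f, h, rfl, rfl⟩ := mem_arcsOf.1 hij
    exact h.1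
  · intro i j hij
    obtain ⟨e, f, h, rfl, rfl⟩ := mem_arcsOf.1 hij
    exact f.2
  · intro i j k hij hik
    obtain ⟨e, f, ⟨hef, b, hb, heb, hfb, hbt⟩, rfl, rfl⟩ := mem_arcsOf.1 hij
    obtain ⟨e', f', ⟨hef', c, hc, hec, hfc, hct⟩, he, rfl⟩ := mem_arcsOf.1 hik
    obtain rfl : e' = e := Fin.ext he
    obtain rfl := hP.eq_of_mem hb hc heb hec
    have h1 := hbt f' hfc
    have h2 := hct f hfb
    simp only [Fin.lt_def] at *
    omega
  · intro i j k hik hjk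
    obtain ⟨e, f, ⟨hef, b, hb, heb, hfb, hbt⟩, rfl, rfl⟩ := mem_arcsOf.1 hik
    obtain ⟨e', f', ⟨hef', c, hc, hec, hfc, hct⟩, rfl, hf⟩ := mem_arcsOf.1 hjk
    obtain rfl : f' = f := Fin.ext hf
    obtain rfl := hP.eq_of_mem hb hc hfb hfc
    have h1 := hbt e' hec
    have h2 := hct e heb
    simp only [Fin.lt_def] at *
    omega

theorem isSetPartition_blocksOf : IsSetPartition (blocksOf n A) := by
  constructor
  · intro b hb
    obtain ⟨x, -, rfl⟩ := Finset.mem_image.1 hb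
    exact ⟨x, by simp⟩
  · intro x
    refine ⟨_, ⟨Finset.mem_image_of_mem _ (Finset.mem_univ x), by simp⟩, ?_⟩
    rintro b ⟨hb, hx⟩
    obtain ⟨y, -, rfl⟩ := Finset.mem_image.1 hb
    simp only [Finset.mem_filter, Finset.mem_univ, true_and] at hx
    rw [hx]

theorem follows_blocksOf_iff {e f : Fin n} :
    Follows (blocksOf n A) e f ↔ e < f ∧ arcRoot A f = arcRoot A e ∧
      ∀ g : Fin n, arcRoot A g = arcRoot A e → ¬(e < g ∧ g < f) := by
  constructor
  · rintro ⟨hef, b, hb, he, hf, hbt⟩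
    obtain ⟨x, -, rfl⟩ := Finset.mem_image.1 hb
    simp only [Finset.mem_filter, Finset.mem_univ, true_and] at he hf hbt
    exact ⟨hef, hf.trans he.symm, fun g hg => hbt g (hg.trans he)⟩
  · rintro ⟨hef, hroot, hbt⟩
    exact ⟨hef, _, Finset.mem_image_of_mem _ (Finset.mem_univ e), by simp, by simpa using hroot,
      by simpa using hbt⟩

theorem IsArcDiagram.arcsOf_blocksOf (h : IsArcDiagram n A S) : arcsOf (blocksOf n A) = A := by
  ext ⟨i, j⟩
  rw [mem_arcsOf]
  constructor
  · rintro ⟨e, f, hef, rfl, rfl⟩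
    obtain ⟨hlt, hroot, hbt⟩ := follows_blocksOf_iff.1 hef
    obtain ⟨k, hk⟩ := IsArcDiagram.exists_mem_of_arcRoot_lt (A := A) (j := f)
      (hroot ▸ (h.arcRoot_le e).trans_lt hlt)
    have hkf := h.lt hk
    have hkroot : arcRoot A k = arcRoot A e := (h.arcRoot_of_mem hk).symm.trans hroot
    rcases lt_trichotomy k e with hke | rfl | hke
    · exact (h.arcRoot_ne_of_between hk hke hlt hkroot.symm).elim
    · exact hk
    · exact (hbt ⟨k, hkf.trans f.2⟩ hkroot ⟨hke, hkf⟩).elim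
  · intro hij
    have hj := h.bound hij
    have hlt := h.lt hij
    refine ⟨⟨i, hlt.trans hj⟩, ⟨j, hj⟩, follows_blocksOf_iff.2 ⟨hlt, h.arcRoot_of_mem hij, ?_⟩,
      rfl, rfl⟩
    exact fun g hg hgb => h.arcRoot_ne_of_between hij hgb.1 hgb.2 hg

theorem IsSetPartition.exists_arcRoot_eq (hP : IsSetPartition P) {b : Finset (Fin n)}
    (hb : b ∈ P) {x : Fin n} (hx : x ∈ b) : ∃ r ∈ b, arcRoot (arcsOf P) x = r := by
  have h := hP.isArcDiagram_arcsOf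
  induction x using WellFoundedLT.induction with
  | _ x ih =>
    by_cases hpred : ∃ i, (i, (x : ℕ)) ∈ arcsOf P
    · obtain ⟨i, hi⟩ := hpred
      obtain ⟨e, f, ⟨hef, c, hc, hec, hfc, -⟩, rfl, hf⟩ := mem_arcsOf.1 hi
      obtain rfl : f = x := Fin.ext hf
      obtain rfl := hP.eq_of_mem hb hc hx hfc
      rw [h.arcRoot_of_mem hi]
      exact ih e hef hec
    · exact ⟨x, hx, IsArcDiagram.arcRoot_of_forall_notMem (not_exists.1 hpred)⟩

theorem IsSetPartition.arcRoot_eq_of_lt (hP : IsSetPartition P) {b : Finset (Fin n)}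
    (hb : b ∈ P) {x y : Fin n} (hx : x ∈ b) (hy : y ∈ b) (hxy : x < y) :
    arcRoot (arcsOf P) y = arcRoot (arcsOf P) x := by
  have h := hP.isArcDiagram_arcsOf
  induction y using WellFoundedLT.induction with
  | _ y ih =>
    obtain ⟨z, hz, hmax⟩ := ({z ∈ b | z < y} : Finset (Fin n)).exists_max_image id
      ⟨x, Finset.mem_filter.2 ⟨hx, hxy⟩⟩
    simp only [Finset.mem_filter, id_eq, and_imp] at hz hmax
    have hfol : Follows P z y :=
      ⟨hz.2, b, hb, hz.1, hy, fun g hg hlt => (hmax g hg hlt.2).not_gt hlt.1⟩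
    rw [h.arcRoot_of_mem (val_mem_arcsOf.2 hfol)]
    rcases (hmax x hx hxy).eq_or_lt with rfl | hlt
    · rfl
    · exact ih z hz.2 hz.1 hlt

theorem IsSetPartition.arcRoot_eq_iff (hP : IsSetPartition P) {b : Finset (Fin n)}
    (hb : b ∈ P) {x y : Fin n} (hx : x ∈ b) :
    arcRoot (arcsOf P) y = arcRoot (arcsOf P) x ↔ y ∈ b := by
  constructor
  · intro hroot
    obtain ⟨c, ⟨hc, hy⟩, -⟩ := hP.2 y
    obtain ⟨r, hrb, hr⟩ := hP.exists_arcRoot_eq hb hx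
    obtain ⟨r', hrc, hr'⟩ := hP.exists_arcRoot_eq hc hy
    obtain rfl : r' = r := Fin.ext (hr'.symm.trans (hroot.trans hr))
    rwa [hP.eq_of_mem hb hc hrb hrc]
  · intro hy
    rcases lt_trichotomy x y with hlt | rfl | hlt
    · exact hP.arcRoot_eq_of_lt hb hx hy hlt
    · rfl
    · exact (hP.arcRoot_eq_of_lt hb hy hx hlt).symm

theorem IsSetPartition.blocksOf_arcsOf (hP : IsSetPartition P) : blocksOf n (arcsOf P) = P := by
  have key {b : Finset (Fin n)} (hb : b ∈ P) {x : Fin n} (hx : x ∈ b) :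
      (Finset.univ.filter fun y : Fin n => arcRoot (arcsOf P) y = arcRoot (arcsOf P) x) = b := by
    ext y
    simp [hP.arcRoot_eq_iff hb hx]
  ext b
  constructor
  · intro hb
    obtain ⟨x, -, rfl⟩ := Finset.mem_image.1 hb
    obtain ⟨c, ⟨hc, hx⟩, -⟩ := hP.2 x
    rwa [key hc hx]
  · intro hb
    obtain ⟨x, hx⟩ := hP.1 b hb
    exact Finset.mem_image.2 ⟨x, Finset.mem_univ x, key hb hx⟩

theorem IsArcDiagram.card_blocksOf (h : IsArcDiagram n A S) :
    (blocksOf n A).card = n - A.card := by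
  have hroots : (blocksOf n A).card = ((Finset.range n).image (arcRoot A)).card := by
    refine (Finset.card_bij' (s := (Finset.range n).image (arcRoot A)) (t := blocksOf n A)
      (fun r _ => Finset.univ.filter fun y : Fin n => arcRoot A y = r)
      (fun b hb => arcRoot A (Finset.mem_image.1 hb).choose) ?_ ?_ ?_ ?_).symm
    · intro r hr
      obtain ⟨j, hj, rfl⟩ := Finset.mem_image.1 hr
      exact Finset.mem_image.2 ⟨⟨j, Finset.mem_range.1 hj⟩, Finset.mem_univ _, rfl⟩
    · intro b hb
      exact Finset.mem_image_of_mem _ (Finset.mem_range.2 (Fin.is_lt _))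
    · intro r hr
      obtain ⟨j, hj, rfl⟩ := Finset.mem_image.1 hr
      generalize_proofs hex
      have hmem : (⟨j, Finset.mem_range.1 hj⟩ : Fin n) ∈
          Finset.univ.filter fun y : Fin n => arcRoot A y = arcRoot A j := by simp
      rw [← hex.choose_spec.2] at hmem
      exact (Finset.mem_filter.1 hmem).2.symm
    · intro b hb
      exact (Finset.mem_image.1 hb).choose_spec.2
  have himage : (Finset.range n).image (arcRoot A) = Finset.range n \ A.image Prod.snd := by
    ext j
    simp only [Finset.mem_image, Finset.mem_range, Finset.mem_sdiff, Prod.exists, exists_eq_right,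
      not_exists]
    rw [← h.arcRoot_eq_self_iff]
    constructor
    · rintro ⟨k, hk, rfl⟩
      exact ⟨(h.arcRoot_le k).trans_lt hk, h.arcRoot_arcRoot k⟩
    · exact fun hj => ⟨j, hj.1, hj.2⟩
  have hsub : A.image Prod.snd ⊆ Finset.range n := by
    intro j hj
    obtain ⟨e, he, rfl⟩ := Finset.mem_image.1 hj
    exact Finset.mem_range.2 (h.lt_of_mem he).2
  rw [hroots, himage, Finset.card_sdiff_of_subset hsub, Finset.card_range,
    Finset.card_image_of_injOn]
  rintro ⟨i, k⟩ hi ⟨j, l⟩ hj hkl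
  obtain rfl : k = l := hkl
  rw [h.right hi hj]

theorem arcCrossings_arcsOf : arcCrossings (arcsOf P) ∅ = rc P := by
  simp only [arcCrossings, Finset.sum_empty, Finset.sum_const_zero, add_zero]
  rw [← Finset.sum_product', ← Finset.card_filter, rc]
  symm
  refine Finset.card_bij
    (fun x _ => (((x.1 : ℕ), (x.2.2.1 : ℕ)), ((x.2.1 : ℕ), (x.2.2.2 : ℕ)))) ?_ ?_ ?_
  · rintro ⟨a, b, c, d⟩ hx
    simp only [Finset.mem_filter, Finset.mem_univ, true_and] at hx
    simp only [Finset.mem_filter, Finset.mem_product, val_mem_arcsOf]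
    exact ⟨⟨hx.2.2.2.1, hx.2.2.2.2⟩, hx.1, hx.2.1, hx.2.2.1⟩
  · rintro ⟨a, b, c, d⟩ _ ⟨a', b', c', d'⟩ _ heq
    simp only [Prod.mk.injEq, Fin.val_inj] at heq ⊢
    tauto
  · rintro ⟨⟨i, k⟩, ⟨j, l⟩⟩ hx
    simp only [Finset.mem_filter, Finset.mem_product] at hx
    obtain ⟨⟨h1, h2⟩, h3⟩ := hx
    obtain ⟨a, c, hac, rfl, rfl⟩ := mem_arcsOf.1 h1
    obtain ⟨b, d, hbd, rfl, rfl⟩ := mem_arcsOf.1 h2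
    exact ⟨(a, b, c, d), Finset.mem_filter.2 ⟨Finset.mem_univ _, h3.1, h3.2.1, h3.2.2, hac, hbd⟩,
      rfl⟩

theorem arcNestings_arcsOf : arcNestings (arcsOf P) ∅ = rn P := by
  simp only [arcNestings, Finset.sum_empty, Finset.sum_const_zero, add_zero]
  rw [← Finset.sum_product', ← Finset.card_filter, rn]
  symm
  refine Finset.card_bij
    (fun x _ => (((x.1 : ℕ), (x.2.2.2 : ℕ)), ((x.2.1 : ℕ), (x.2.2.1 : ℕ)))) ?_ ?_ ?_
  · rintro ⟨a, b, c, d⟩ hx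
    simp only [Finset.mem_filter, Finset.mem_univ, true_and] at hx
    simp only [Finset.mem_filter, Finset.mem_product, val_mem_arcsOf]
    exact ⟨⟨hx.2.2.2.1, hx.2.2.2.2⟩, hx.1, hx.2.2.1⟩
  · rintro ⟨a, b, c, d⟩ _ ⟨a', b', c', d'⟩ _ heq
    simp only [Prod.mk.injEq, Fin.val_inj] at heq ⊢
    tauto
  · rintro ⟨⟨i, l⟩, ⟨j, k⟩⟩ hx
    simp only [Finset.mem_filter, Finset.mem_product] at hx
    obtain ⟨⟨h1, h2⟩, h3⟩ := hx
    obtain ⟨a, d, had, rfl, rfl⟩ := mem_arcsOf.1 h1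
    obtain ⟨b, c, hbc, rfl, rfl⟩ := mem_arcsOf.1 h2
    exact ⟨(a, b, c, d),
      Finset.mem_filter.2 ⟨Finset.mem_univ _, h3.1, hbc.1, h3.2, had, hbc⟩, rfl⟩

theorem IsSetPartition.arcWeight_arcsOf (hP : IsSetPartition P) (q t lam : ℝ) :
    arcWeight q t lam n (arcsOf P) ∅ = lam ^ P.card * q ^ rc P * t ^ rn P := by
  rw [arcWeight, arcCrossings_arcsOf, arcNestings_arcsOf,
    ← hP.isArcDiagram_arcsOf.card_blocksOf, hP.blocksOf_arcsOf]

end Partition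

theorem sum_setPartitions_eq (q t lam : ℝ) (n : ℕ) :
    ∑ P ∈ Finset.univ.filter (IsSetPartition (n := n)), lam ^ P.card * q ^ rc P * t ^ rn P =
      ∑ x ∈ (arcDiagrams n).filter (fun x => x.2 = ∅), arcWeight q t lam n x.1 x.2 := by
  refine Finset.sum_bij' (fun P _ => (arcsOf P, ∅)) (fun x _ => blocksOf n x.1) ?_ ?_ ?_ ?_ ?_
  · intro P hP
    exact Finset.mem_filter.2
      ⟨mem_arcDiagrams.2 (Finset.mem_filter.1 hP).2.isArcDiagram_arcsOf, rfl⟩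
  · intro x _
    exact Finset.mem_filter.2 ⟨Finset.mem_univ _, isSetPartition_blocksOf⟩
  · intro P hP
    exact (Finset.mem_filter.1 hP).2.blocksOf_arcsOf
  · rintro ⟨A, S⟩ hx
    obtain ⟨h, rfl : S = ∅⟩ := Finset.mem_filter.1 hx
    simp only [(mem_arcDiagrams.1 h).arcsOf_blocksOf]
  · intro P hP
    exact ((Finset.mem_filter.1 hP).2.arcWeight_arcsOf q t lam).symm

/-- Combinatorial moment formula for the `(q,t)`-Poisson distribution: in the one-mode
`(q,t)`-Fock model with `(q,t)`-Poisson operator `p = N + s·(a† + a) + λ·id` (`s = √λ`),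
the vacuum expectation of `p^n` (the coefficient of `b_0` in `p^n b_0`) equals
`∑_{π ∈ P(n)} λ^{|π|} q^{rc(π)} t^{rn(π)}`. -/
theorem qt_poisson_moment_formula (q t lam : ℝ) (hq : q ∈ Set.Ioo (-1 : ℝ) 1)
    (hqt : |q| < t) (ht : t ≤ 1) (hlam : 0 < lam) (s : ℝ) (hs : s = Real.sqrt lam)
    (acr aan Nop : Module.End ℝ (ℕ →₀ ℝ))
    (hacr : ∀ m : ℕ, acr (Finsupp.single m 1) = Finsupp.single (m + 1) 1)
    (haan0 : aan (Finsupp.single 0 1) = 0)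
    (haan : ∀ m : ℕ, 1 ≤ m → aan (Finsupp.single m 1)
      = qtNum q t m • Finsupp.single (m - 1) 1)
    (hN : ∀ m : ℕ, Nop (Finsupp.single m 1) = qtNum q t m • Finsupp.single m 1)
    (p : Module.End ℝ (ℕ →₀ ℝ)) (hp : p = Nop + s • (acr + aan) + lam • 1)
    (n : ℕ) (hn : 1 ≤ n) :
    ((p ^ n) (Finsupp.single 0 1)) 0
      = ∑ P ∈ Finset.univ.filter (IsSetPartition (n := n)),
          lam ^ P.card * q ^ rc P * t ^ rn P := by
  have hs2 : s ^ 2 = lam := by rw [hs, Real.sq_sqrt hlam.le]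
  have hs0 : s ≠ 0 := by
    rintro rfl
    simp at hs2
    exact hlam.ne hs2
  have hpm (m : ℕ) : p (Finsupp.single m 1) = qtNum q t m • Finsupp.single m 1 +
      s • (Finsupp.single (m + 1) 1 + qtNum q t m • Finsupp.single (m - 1) 1) +
      s ^ 2 • Finsupp.single m 1 := by
    have ha : aan (Finsupp.single m 1) = qtNum q t m • Finsupp.single (m - 1) 1 := by
      rcases Nat.eq_zero_or_pos m with rfl | hm
      · simp [haan0, qtNum]
      · exact haan m hm
    rw [hp, hs2]
    simp only [LinearMap.add_apply, LinearMap.smul_apply, Module.End.one_apply, hN, hacr, ha]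
  rw [pow_apply_vacuum q t s hs0 p hpm, Finsupp.finsetSum_apply, sum_setPartitions_eq,
    Finset.sum_filter, hs2]
  refine Finset.sum_congr rfl fun x _ => ?_
  by_cases hx : x.2 = ∅
  · simp [hx]
  · simp [hx]
end
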